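/- Let F be a field, let C ⊆ F^n be a linear subspace containing a nonzero vector with minimum distance d := d(C), and let α ≥ 1 be a real number such that C is α-non-overlapping. Then every matrix M ∈ C⊗C whose rank is at least 2 satisfies ‖M‖₀ ≥ α·d² (as an inequality of real numbers). -/

import Mathlib

open Matrix

noncomputable section

/-- Hamming weight of a vector: number of nonzero coordinates. -/
def hw {F : Type*} [Zero F] {n : ℕ} (x : Fin n → F) : ℕ :=
  (Function.support x).ncard

/-- Hamming weight of a matrix: number of nonzero entries. -/
def hwM {F : Type*} [Zero F] {n m : ℕ} (M : Matrix (Fin n) (Fin m) F) : ℕ :=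
  (Function.support fun p : Fin n × Fin m => M p.1 p.2).ncard

/-- Minimum distance of a linear code. -/
def dmin {F : Type*} [Field F] {n : ℕ} (C : Submodule F (Fin n → F)) : ℕ :=
  sInf {w | ∃ u ∈ C, u ≠ 0 ∧ hw u = w}

/-- Tensor code: matrices whose columns lie in `U` and rows lie in `V`. -/
def tensorCode {F : Type*} [Field F] {n m : ℕ} (U : Submodule F (Fin n → F))
    (V : Submodule F (Fin m → F)) : Set (Matrix (Fin n) (Fin m) F) :=
  {M | (∀ j, (fun i => M i j) ∈ U) ∧ ∀ i, (fun j => M i j) ∈ V}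

/-- `C` is `α`-non-overlapping: any two linearly independent codewords have
joint support of size at least `α · d(C)`. -/
def NonOverlapping {F : Type*} [Field F] {n : ℕ} (C : Submodule F (Fin n → F))
    (α : ℝ) : Prop :=
  ∀ u ∈ C, ∀ v ∈ C, LinearIndependent F ![u, v] →
    α * (dmin C : ℝ) ≤ ((Function.support u ∪ Function.support v).ncard : ℝ)

theorem dmin_le_hw {F : Type*} [Field F] {n : ℕ} {C : Submodule F (Fin n → F)}
    {u : Fin n → F} (hu : u ∈ C) (hu0 : u ≠ 0) : dmin C ≤ hw u :=
  Nat.sInf_le ⟨u, hu, hu0, rfl⟩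

theorem hwM_eq_sum_hw_row {F : Type*} [Zero F] {n m : ℕ} (M : Matrix (Fin n) (Fin m) F) :
    hwM M = ∑ i, hw (M i) := by
  classical
  simp only [hwM, hw, Set.ncard_eq_toFinset_card']
  rw [← Finset.card_sigma]
  refine Finset.card_bij (fun p _ => ⟨p.1, p.2⟩) ?_ ?_ ?_
  · simp
  · rintro ⟨a, b⟩ _ ⟨c, d⟩ _ h
    simpa using h
  · rintro ⟨a, b⟩ h
    exact ⟨(a, b), by simpa using h, rfl⟩

theorem exists_linearIndependent_cols {F : Type*} [Field F] {n m : ℕ}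
    {M : Matrix (Fin n) (Fin m) F} (hrank : 2 ≤ M.rank) :
    ∃ j k, LinearIndependent F ![M.col j, M.col k] := by
  rw [Matrix.rank_eq_finrank_span_cols] at hrank
  obtain ⟨f, hf, -, hli⟩ := Submodule.exists_fun_fin_finrank_span_eq F (Set.range M.col)
  obtain ⟨j, hj⟩ := hf (Fin.castLE hrank 0)
  obtain ⟨k, hk⟩ := hf (Fin.castLE hrank 1)
  refine ⟨j, k, ?_⟩
  have hcols : ![M.col j, M.col k] = f ∘ Fin.castLE hrank := by
    ext i : 1
    fin_cases i
    · exact hj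
    · exact hk
  exact hcols ▸ hli.comp _ (Fin.castLE_injective hrank)

/-- If every row of `M` lies in `C`, each nonzero row contributes at least `dmin C`. -/
theorem card_mul_dmin_le_hwM {F : Type*} [Field F] {n m : ℕ} {C : Submodule F (Fin m → F)}
    {M : Matrix (Fin n) (Fin m) F} (hrow : ∀ i, M i ∈ C) {s : Set (Fin n)}
    (hs : ∀ i ∈ s, M i ≠ 0) : s.ncard * dmin C ≤ hwM M := by
  classical
  rw [hwM_eq_sum_hw_row, Set.ncard_eq_toFinset_card', ← smul_eq_mul]
  calc s.toFinset.card • dmin C ≤ ∑ i ∈ s.toFinset, hw (M i) :=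
        Finset.card_nsmul_le_sum _ _ _ fun i hi =>
          dmin_le_hw (hrow i) (hs i (Set.mem_toFinset.mp hi))
    _ ≤ ∑ i, hw (M i) := Finset.sum_le_sum_of_subset (Finset.subset_univ _)

theorem stmt2 {F : Type*} [Field F] {n : ℕ} (C : Submodule F (Fin n → F))
    (hC : ∃ u ∈ C, u ≠ 0) (α : ℝ) (hα : 1 ≤ α) (hno : NonOverlapping C α)
    (M : Matrix (Fin n) (Fin n) F) (hM : M ∈ tensorCode C C)
    (hrank : 2 ≤ M.rank) :
    α * (dmin C : ℝ) ^ 2 ≤ (hwM M : ℝ) := by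
  obtain ⟨j, k, hli⟩ := exists_linearIndependent_cols hrank
  have hcard := hno _ (hM.1 j) _ (hM.1 k) hli
  have hrows : ∀ i ∈ Function.support (M.col j) ∪ Function.support (M.col k), M i ≠ 0 := by
    rintro i (hi | hi) h0
    · exact hi (congrFun h0 j)
    · exact hi (congrFun h0 k)
  calc α * (dmin C : ℝ) ^ 2 = α * dmin C * dmin C := by ring
    _ ≤ ((Function.support (M.col j) ∪ Function.support (M.col k)).ncard : ℝ) * dmin C :=
        mul_le_mul_of_nonneg_right hcard (Nat.cast_nonneg _)
    _ ≤ hwM M := mod_cast card_mul_dmin_le_hwM hM.2 hrows
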